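/- Let G be a connected simple graph on a finite vertex type V whose number of edges equals its number of vertices, and let C be a cycle in G of length k ≥ 6 passing consecutively through vertices v1, v2, v3. Let G' be the clasp of G at (v1, v3). Then G' is connected, the number of edges of G' equals |V|, G' contains a cycle of length k - 2, and every cycle of G' has length k - 2. -/

import Mathlib

/-- The clasp of a simple graph `G` at a pair of vertices `(v₁, v₃)`: `x` and `y` are
adjacent in the clasp iff `{x, y} = {v₁, v₃}`, or `v₃ ∉ {x, y}` and (`x` and `y` are
adjacent in `G`, or `x = v₁` and `y` is adjacent to `v₃` in `G`, or `y = v₁` and `x`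
is adjacent to `v₃` in `G`).  (As a simple graph it is in addition loopless.) -/
def SimpleGraph.clasp {V : Type*} (G : SimpleGraph V) (v₁ v₃ : V) : SimpleGraph V :=
  SimpleGraph.fromRel (fun x y =>
    s(x, y) = s(v₁, v₃) ∨
      (x ≠ v₃ ∧ y ≠ v₃ ∧
        (G.Adj x y ∨ (x = v₁ ∧ G.Adj v₃ y) ∨ (y = v₁ ∧ G.Adj v₃ x))))

namespace SimpleGraph

variable {V : Type*} {G : SimpleGraph V}

/-- If two distinct vertices are joined to a third one by edges of a cycle, then the rest of the
cycle is a path between them. -/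
theorem Walk.IsCycle.exists_isPath_of_mem_edges {u v a b : V} {c : G.Walk u u} (hc : c.IsCycle)
    (hab : a ≠ b) (ha : s(v, a) ∈ c.edges) (hb : s(v, b) ∈ c.edges) :
    ∃ p : G.Walk a b, p.IsPath ∧ p.length + 2 = c.length := by
  classical
  have hv : v ∈ c.support := c.fst_mem_support_of_mem_edges ha
  have hc' : (c.rotate v hv).IsCycle := (Walk.isCycle_rotate hv).2 hc
  have ha' : s(v, a) ∈ (c.rotate v hv).edges := (c.rotate_edges v hv).mem_iff.2 ha
  have hb' : s(v, b) ∈ (c.rotate v hv).edges := (c.rotate_edges v hv).mem_iff.2 hb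
  rw [← c.length_rotate v hv]
  generalize c.rotate v hv = d at hc' ha' hb'
  cases d with
  | nil => simp at ha'
  | @cons _ x _ h q =>
    obtain ⟨hq, -⟩ := (Walk.cons_isCycle_iff q h).1 hc'
    have key : ∀ y, s(v, y) ∈ (Walk.cons h q).edges → y = x ∨ y = q.penultimate := by
      intro y hy
      rw [Walk.edges_cons, List.mem_cons] at hy
      rcases hy with hy | hy
      · exact .inl (Sym2.congr_right.1 hy)
      · exact .inr (hq.eq_penultimate_of_mem_edges hy)
    have hlen : q.dropLast.length + 2 = (Walk.cons h q).length := by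
      have := hc'.three_le_length
      simp only [Walk.length_cons, Walk.length_dropLast] at this ⊢
      omega
    rcases key a ha' with rfl | rfl <;> rcases key b hb' with rfl | rfl
    · exact absurd rfl hab
    · exact ⟨_, hq.dropLast, hlen⟩
    · exact ⟨_, hq.dropLast.reverse, by simpa using hlen⟩
    · exact absurd rfl hab

section Unicyclic

variable [Finite V]

/-- A connected graph with as many edges as vertices has every cycle contained in every other. -/
theorem Connected.edges_subset_of_isCycle (hG : G.Connected)
    (hcard : G.edgeSet.ncard = Nat.card V) {u w : V} {c : G.Walk u u} {d : G.Walk w w}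
    (hc : c.IsCycle) (hd : d.IsCycle) : c.edges ⊆ d.edges := by
  intro e he
  by_contra hed
  induction e with | h x y
  have hbr : ¬ G.IsBridge s(x, y) := fun h ↦ h.notMem_edges_of_isCycle hc he
  have hmem : s(x, y) ∈ G.edgeSet := c.edges_subset_edgeSet he
  have htree : (G.deleteEdges {s(x, y)}).IsTree := by
    refine isTree_iff_connected_and_card.2 ⟨hG.connected_delete_edge_of_not_isBridge hbr, ?_⟩
    rw [Nat.card_coe_set_eq, edgeSet_deleteEdges, ← hcard]
    exact Set.ncard_sdiff_singleton_add_one hmem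
  exact htree.isAcyclic _ (hd.toDeleteEdges G {s(x, y)} fun e he hxy ↦ hed (hxy ▸ he))

theorem Connected.length_eq_of_isCycle (hG : G.Connected)
    (hcard : G.edgeSet.ncard = Nat.card V) {u w : V} {c : G.Walk u u} {d : G.Walk w w}
    (hc : c.IsCycle) (hd : d.IsCycle) : c.length = d.length := by
  rw [← c.length_edges, ← d.length_edges]
  exact le_antisymm
    (hc.edges_nodup.subperm (hG.edges_subset_of_isCycle hcard hc hd)).length_le
    (hd.edges_nodup.subperm (hG.edges_subset_of_isCycle hcard hd hc)).length_le

theorem Connected.card_le_ncard_edgeSet_of_isCycle (hG : G.Connected) {u : V} {c : G.Walk u u}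
    (hc : c.IsCycle) : Nat.card V ≤ G.edgeSet.ncard := by
  have hle := hG.card_vert_le_card_edgeSet_add_one
  rw [Nat.card_coe_set_eq] at hle
  by_contra hlt
  refine (isTree_iff_connected_and_card.2 ⟨hG, ?_⟩ : G.IsTree).isAcyclic c hc
  rw [Nat.card_coe_set_eq]
  omega

end Unicyclic

section Clasp

variable {v₁ v₂ v₃ : V}

theorem clasp_adj {x y : V} : (G.clasp v₁ v₃).Adj x y ↔ x ≠ y ∧ (s(x, y) = s(v₁, v₃) ∨
    (x ≠ v₃ ∧ y ≠ v₃ ∧ (G.Adj x y ∨ (x = v₁ ∧ G.Adj v₃ y) ∨ (y = v₁ ∧ G.Adj v₃ x)))) := by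
  simp only [clasp, fromRel_adj, G.adj_comm y x, Sym2.eq_swap (a := y)]
  tauto

theorem Connected.clasp (hG : G.Connected) (h₁₃ : v₁ ≠ v₃) : (G.clasp v₁ v₃).Connected := by
  classical
  have : Nonempty V := ⟨v₁⟩
  have hv : ∀ x, (G.clasp v₁ v₃).Reachable x (if x = v₃ then v₁ else x) := by
    intro x
    split_ifs with hx
    · subst hx
      exact (Adj.reachable (clasp_adj.2 ⟨h₁₃, .inl rfl⟩)).symm
    · rfl
  have hadj : ∀ x y, G.Adj x y → (G.clasp v₁ v₃).Reachable (if x = v₃ then v₁ else x)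
      (if y = v₃ then v₁ else y) := by
    intro x y h
    have hne := h.ne
    have hsymm := h.symm
    split_ifs with hx hy hy
    · rfl
    · obtain rfl | hy₁ := eq_or_ne y v₁
      · rfl
      · exact Adj.reachable (clasp_adj.2 (by subst hx; grind))
    · obtain rfl | hx₁ := eq_or_ne x v₁
      · rfl
      · exact Adj.reachable (clasp_adj.2 (by subst hy; grind))
    · exact Adj.reachable (clasp_adj.2 (by grind))
  have hwalk : ∀ x y, G.Walk x y → (G.clasp v₁ v₃).Reachable x y := by
    intro x y p
    induction p with
    | nil => rfl
    | cons h _ ih => exact (((hv _).trans (hadj _ _ h)).trans (hv _).symm).trans ih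
  exact ⟨fun x y ↦ (hG x y).elim (hwalk x y)⟩

theorem ncard_edgeSet_clasp_le [Finite V] (h₁₃ : v₁ ≠ v₃) (h₁₂ : G.Adj v₁ v₂)
    (h₂₃ : G.Adj v₂ v₃) :
    (G.clasp v₁ v₃).edgeSet.ncard ≤ G.edgeSet.ncard := by
  classical
  let f : Sym2 V → Sym2 V := fun e ↦
    if e = s(v₂, v₃) then s(v₁, v₃) else e.map (fun x ↦ if x = v₃ then v₁ else x)
  refine (Set.ncard_le_ncard (t := f '' G.edgeSet) ?_ (Set.toFinite _)).trans
    (Set.ncard_image_le (Set.toFinite _))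
  have hf : ∀ x y, G.Adj x y → x ≠ v₃ → y ≠ v₃ → s(x, y) ∈ f '' G.edgeSet := by
    intro x y h hx hy
    refine ⟨s(x, y), h, ?_⟩
    have : s(x, y) ≠ s(v₂, v₃) := by grind
    simp [f, this, hx, hy]
  have hf₃ : ∀ y, G.Adj v₃ y → s(v₁, y) ∈ f '' G.edgeSet := by
    intro y h
    have hy : y ≠ v₃ := h.ne'
    obtain rfl | hy₂ := eq_or_ne y v₂
    · exact hf _ _ h₁₂ h₁₃ hy
    · refine ⟨s(v₃, y), h, ?_⟩
      have : s(v₃, y) ≠ s(v₂, v₃) := by grind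
      simp [f, this, hy]
  intro e
  induction e with | h x y
  rw [mem_edgeSet, clasp_adj]
  rintro ⟨-, he | ⟨hx, hy, h | ⟨rfl, h⟩ | ⟨rfl, h⟩⟩⟩
  · rw [he]
    exact ⟨s(v₂, v₃), h₂₃, by simp [f]⟩
  · exact hf x y h hx hy
  · exact hf₃ y h
  · rw [Sym2.eq_swap]
    exact hf₃ x h

/-- A path from `v₃` to `v₁` of length at least `4` gives a cycle of the same length in the
clasp at `(v₁, v₃)`. -/
theorem exists_isCycle_clasp {p : G.Walk v₃ v₁} (hp : p.IsPath) (hlen : 4 ≤ p.length) :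
    ∃ c : (G.clasp v₁ v₃).Walk v₁ v₁, c.IsCycle ∧ c.length = p.length := by
  cases p with
  | nil => simp at hlen
  | @cons _ x _ h q =>
    obtain ⟨hq, hv₃⟩ := (Walk.cons_isPath_iff h q).1 hp
    have hx : x ≠ v₃ := by rintro rfl; exact hv₃ q.start_mem_support
    have h₁₃ : v₁ ≠ v₃ := by rintro rfl; exact hv₃ q.end_mem_support
    have hlq : q.length ≠ 0 ∧ q.length ≠ 1 := by
      rw [Walk.length_cons] at hlen
      omega
    have hx₁ : v₁ ≠ x := by
      rintro rfl
      exact hlq.1 (Walk.length_eq_zero_iff.2 (Walk.isPath_iff_nil.1 hq))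
    have hadj : (G.clasp v₁ v₃).Adj v₁ x := clasp_adj.2 ⟨hx₁, .inr ⟨h₁₃, hx, .inr (.inl ⟨rfl, h⟩)⟩⟩
    have hedges : ∀ e ∈ q.edges, e ∈ (G.clasp v₁ v₃).edgeSet := by
      intro e he
      induction e with | h a b
      have hab : G.Adj a b := q.edges_subset_edgeSet he
      refine clasp_adj.2 ⟨hab.ne, .inr ⟨?_, ?_, .inl hab⟩⟩
      · rintro rfl
        exact hv₃ (q.fst_mem_support_of_mem_edges he)
      · rintro rfl
        exact hv₃ (q.snd_mem_support_of_mem_edges he)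
    refine ⟨.cons hadj (q.transfer _ hedges), ?_, by simp⟩
    rw [Walk.cons_isCycle_iff, Walk.edges_transfer]
    exact ⟨hq.transfer hedges, fun hmem ↦
      hlq.2 (hq.length_eq_one_of_mem_edges (Sym2.eq_swap ▸ hmem))⟩

end Clasp

end SimpleGraph

/-- Let `G` be a connected simple graph on a finite vertex type whose
number of edges equals its number of vertices, and let `C` be a cycle in `G` of length
`k ≥ 6` passing consecutively through vertices `v₁, v₂, v₃`. Let `G'` be the clasp of
`G` at `(v₁, v₃)`. Then `G'` is connected, the number of edges of `G'` equals `|V|`,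
`G'` contains a cycle of length `k - 2`, and every cycle of `G'` has length `k - 2`. -/
theorem stmt_6 {V : Type*} [Fintype V] [DecidableEq V]
    (G : SimpleGraph V) [DecidableRel G.Adj]
    (hconn : G.Connected)
    (hcard : G.edgeFinset.card = Fintype.card V)
    (u : V) (C : G.Walk u u) (hC : C.IsCycle)
    (k : ℕ) (hk : C.length = k) (hk6 : 6 ≤ k)
    (v₁ v₂ v₃ : V) (h₁₂ : v₁ ≠ v₂) (h₂₃ : v₂ ≠ v₃) (h₁₃ : v₁ ≠ v₃)
    (he₁ : s(v₁, v₂) ∈ C.edges) (he₂ : s(v₂, v₃) ∈ C.edges) :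
    (G.clasp v₁ v₃).Connected ∧
      (G.clasp v₁ v₃).edgeSet.ncard = Fintype.card V ∧
      (∃ (w : V) (c : (G.clasp v₁ v₃).Walk w w), c.IsCycle ∧ c.length = k - 2) ∧
      (∀ (w : V) (c : (G.clasp v₁ v₃).Walk w w), c.IsCycle → c.length = k - 2) := by
  have hadj₁₂ : G.Adj v₁ v₂ := C.edges_subset_edgeSet he₁
  have hadj₂₃ : G.Adj v₂ v₃ := C.edges_subset_edgeSet he₂
  have hconn' := hconn.clasp h₁₃
  obtain ⟨p, hp, hpl⟩ := hC.exists_isPath_of_mem_edges h₁₃.symm he₂ (Sym2.eq_swap ▸ he₁)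
  obtain ⟨c, hc, hcl⟩ := SimpleGraph.exists_isCycle_clasp hp (by omega)
  have hcard' : (G.clasp v₁ v₃).edgeSet.ncard = Nat.card V := by
    refine le_antisymm ?_ (hconn'.card_le_ncard_edgeSet_of_isCycle hc)
    refine (SimpleGraph.ncard_edgeSet_clasp_le h₁₃ hadj₁₂ hadj₂₃).trans ?_
    rw [Nat.card_eq_fintype_card, ← hcard, ← G.coe_edgeFinset, Set.ncard_coe_finset]
  refine ⟨hconn', by rw [hcard', Nat.card_eq_fintype_card], ⟨v₁, c, hc, by omega⟩, ?_⟩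
  intro w d hd
  have := hconn'.length_eq_of_isCycle hcard' hd hc
  omega
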